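/- Let ρ > 0 and Π_ρ = [0,1] × [0,ρ]³ × [−ρ,0]. Assume (a) f : Π_ρ → ℝ is continuous and there is a continuous function δ̲_ρ : [0,1] → [0,∞) with f(t,u,v,w,z) ≥ δ̲_ρ(t) on Π_ρ; (b) H : K̄_ρ → ℝ is continuous and bounded and there is η̲_ρ ≥ 0 with H[u] ≥ η̲_ρ for every u ∈ ∂K_ρ. Then for the operator Tu(t) = γ(t)H[u] + ∫₀¹ k(t,s) f(s, u(s), u′(s), u″(s), u‴(s)) ds one has ‖Tu‖₃ ≥ η̲_ρ + ∫₀¹ δ̲_ρ(s) ds for every u ∈ ∂K_ρ, and hence inf_{u ∈ ∂K_ρ} ‖Tu‖₃ ≥ η̲_ρ + ∫₀¹ δ̲_ρ(s) ds. -/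

import Mathlib

open Set MeasureTheory Filter Topology

/-- The Green's function `k(t,s) = (1/6)(3t²s − t³)` for `s ≥ t`,
`k(t,s) = (1/6)(3s²t − s³)` for `s ≤ t`. -/
noncomputable def kern (t s : ℝ) : ℝ :=
  if t ≤ s then (3 * t ^ 2 * s - t ^ 3) / 6 else (3 * s ^ 2 * t - s ^ 3) / 6

/-- `γ(t) = (1/6)(3t² − t³)`. -/
noncomputable def gam (t : ℝ) : ℝ := (3 * t ^ 2 - t ^ 3) / 6

/-- The sup norm over `[0,1]`: `‖w‖_∞ = sup_{t∈[0,1]} |w(t)|`. -/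
noncomputable def supN (w : ℝ → ℝ) : ℝ := ⨆ t : Icc (0:ℝ) 1, |w ↑t|

/-- The `C³[0,1]` norm `‖u‖₃ = max_{j=0,…,3} ‖u⁽ʲ⁾‖_∞`. -/
noncomputable def norm3 (u : ℝ → ℝ) : ℝ :=
  max (max (supN u) (supN (deriv u))) (max (supN (deriv^[2] u)) (supN (deriv^[3] u)))

/-- The cone `K = {u ∈ C³[0,1] : u, u′, u″, −u‴ ≥ 0 on [0,1]}`, where elements of
`C³[0,1]` are represented by three times continuously differentiable functions on `ℝ`. -/
def coneK : Set (ℝ → ℝ) :=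
  {u | ContDiff ℝ 3 u ∧ ∀ t ∈ Icc (0:ℝ) 1,
    0 ≤ u t ∧ 0 ≤ deriv u t ∧ 0 ≤ deriv^[2] u t ∧ 0 ≤ -(deriv^[3] u t)}

/-- `K̄_ρ = {u ∈ K : ‖u‖₃ ≤ ρ}`. -/
def Kbar (ρ : ℝ) : Set (ℝ → ℝ) := {u ∈ coneK | norm3 u ≤ ρ}

/-- `∂K_ρ = {u ∈ K : ‖u‖₃ = ρ}`. -/
def Kbdry (ρ : ℝ) : Set (ℝ → ℝ) := {u ∈ coneK | norm3 u = ρ}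

/-- `Π_ρ = [0,1] × [0,ρ]³ × [−ρ,0]`. -/
def PiSet (ρ : ℝ) : Set (ℝ × ℝ × ℝ × ℝ × ℝ) :=
  {p | p.1 ∈ Icc (0:ℝ) 1 ∧ p.2.1 ∈ Icc 0 ρ ∧ p.2.2.1 ∈ Icc 0 ρ ∧
       p.2.2.2.1 ∈ Icc 0 ρ ∧ p.2.2.2.2 ∈ Icc (-ρ) 0}

/-- The operator `Tu(t) = γ(t)H[u] + ∫₀¹ k(t,s) f(s, u(s), u′(s), u″(s), u‴(s)) ds`. -/
noncomputable def Toper (f : ℝ × ℝ × ℝ × ℝ × ℝ → ℝ) (H : (ℝ → ℝ) → ℝ) (u : ℝ → ℝ) :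
    ℝ → ℝ :=
  fun t => gam t * H u +
    ∫ s in (0:ℝ)..1, kern t s * f (s, u s, deriv u s, deriv^[2] u s, deriv^[3] u s)

/-- Continuity of a functional `H` on a subset `S` of `C³[0,1]` with respect to `‖·‖₃`. -/
def ContOn3 (H : (ℝ → ℝ) → ℝ) (S : Set (ℝ → ℝ)) : Prop :=
  ∀ u ∈ S, ∀ ε > (0:ℝ), ∃ δ > (0:ℝ), ∀ v ∈ S, norm3 (u - v) < δ → |H u - H v| < ε

/-- Boundedness of a functional `H` on a subset `S` of `C³[0,1]`. -/
def BddOn3 (H : (ℝ → ℝ) → ℝ) (S : Set (ℝ → ℝ)) : Prop :=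
  ∃ M : ℝ, ∀ u ∈ S, |H u| ≤ M

/-- The truncated power `t ↦ (t - s)₊ ^ (n + 2)` is differentiable on all of `ℝ`. -/
theorem hasDerivAt_max_sub_zero_pow (n : ℕ) (s t : ℝ) :
    HasDerivAt (fun t : ℝ => max (t - s) 0 ^ (n + 2))
      (((n + 2 : ℕ) : ℝ) * max (t - s) 0 ^ (n + 1)) t := by
  have hpow : HasDerivAt (fun t : ℝ => (t - s) ^ (n + 2))
      (((n + 2 : ℕ) : ℝ) * (t - s) ^ (n + 1)) t := by
    simpa using ((hasDerivAt_id t).sub_const s).fun_pow (n + 2)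
  rcases lt_trichotomy t s with h | rfl | h
  · rw [max_eq_right (by linarith)]
    refine (by simpa using hasDerivAt_const t (0 : ℝ) : HasDerivAt (fun _ : ℝ => (0 : ℝ)) _ t)
      |>.congr_of_eventuallyEq ?_
    filter_upwards [Iio_mem_nhds h] with x hx
    rw [max_eq_right (by linarith [mem_Iio.1 hx])]
    simp
  · rw [← hasDerivWithinAt_univ, ← Iic_union_Ici (a := t)]
    refine HasDerivWithinAt.union ?_ ?_
    · refine (by simpa using hasDerivWithinAt_const t (Iic t) (0 : ℝ) :
        HasDerivWithinAt (fun _ : ℝ => (0 : ℝ)) _ (Iic t) t).congr ?_ (by simp)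
      intro x hx
      rw [max_eq_right (by linarith [mem_Iic.1 hx])]
      simp
    · refine (by simpa using hpow.hasDerivWithinAt (s := Ici t) :
        HasDerivWithinAt (fun x : ℝ => (x - t) ^ (n + 2)) _ (Ici t) t).congr ?_ (by simp)
      intro x hx
      rw [max_eq_left (by linarith [mem_Ici.1 hx])]
  · rw [max_eq_left (by linarith)]
    refine hpow.congr_of_eventuallyEq ?_
    filter_upwards [Ioi_mem_nhds h] with x hx
    rw [max_eq_left (by linarith [mem_Ioi.1 hx])]

theorem intervalIntegrable_max_sub_zero_pow_mul {g : ℝ → ℝ}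
    (hg : IntervalIntegrable g volume 0 1) (n : ℕ) (t : ℝ) :
    IntervalIntegrable (fun s => max (t - s) 0 ^ n * g s) volume 0 1 :=
  hg.continuousOn_mul (by fun_prop)

theorem hasDerivAt_integral_max_sub_zero_pow {g : ℝ → ℝ}
    (hg : IntervalIntegrable g volume 0 1) (n : ℕ) (t : ℝ) :
    HasDerivAt (fun t : ℝ => ∫ s in (0:ℝ)..1, max (t - s) 0 ^ (n + 2) * g s)
      (((n + 2 : ℕ) : ℝ) * ∫ s in (0:ℝ)..1, max (t - s) 0 ^ (n + 1) * g s) t := by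
  rw [← intervalIntegral.integral_const_mul]
  refine (intervalIntegral.hasDerivAt_integral_of_dominated_loc_of_deriv_le
    (F' := fun t s => ((n + 2 : ℕ) : ℝ) * (max (t - s) 0 ^ (n + 1) * g s))
    (bound := fun s => ((n + 2 : ℕ) : ℝ) * ((|t| + 1) ^ (n + 1) * |g s|))
    (Metric.ball_mem_nhds t one_pos) (Eventually.of_forall fun x => ?_)
    (intervalIntegrable_max_sub_zero_pow_mul hg _ t) ?_ ?_
    ((hg.abs.const_mul _).const_mul _) ?_).2
  · exact (intervalIntegrable_max_sub_zero_pow_mul hg _ x).def'.aestronglyMeasurable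
  · exact ((intervalIntegrable_max_sub_zero_pow_mul hg _ t).const_mul _).def'.aestronglyMeasurable
  · refine Eventually.of_forall fun s hs x hx => ?_
    rw [uIoc_of_le zero_le_one] at hs
    have hx' : |x - t| < 1 := by simpa [Real.dist_eq] using hx
    have hle : max (x - s) 0 ≤ |t| + 1 := by
      refine max_le ?_ (by positivity)
      linarith [hs.1, le_abs_self t, le_abs_self (x - t)]
    rw [Real.norm_eq_abs, abs_mul, abs_mul, Nat.abs_cast, abs_of_nonneg (by positivity)]
    gcongr
  · refine Eventually.of_forall fun s _ x _ => ?_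
    simpa [mul_assoc] using (hasDerivAt_max_sub_zero_pow n s x).mul_const (g s)

theorem hasDerivAt_integral_max_sub_zero {g : ℝ → ℝ}
    (hg : IntervalIntegrable g volume 0 1) (t : ℝ) :
    HasDerivAt (fun t : ℝ => ∫ s in (0:ℝ)..1, max (t - s) 0 * g s)
      (∫ s in (0:ℝ)..1, (Iio t).indicator g s) t := by
  have hint (x : ℝ) : IntervalIntegrable (fun s => max (x - s) 0 * g s) volume 0 1 := by
    simpa using intervalIntegrable_max_sub_zero_pow_mul hg 1 x
  refine (intervalIntegral.hasDerivAt_integral_of_dominated_loc_of_lip (bound := g)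
    univ_mem (Eventually.of_forall fun x => ?_) (hint t) ?_ ?_ hg ?_).2
  · exact (hint x).def'.aestronglyMeasurable
  · exact hg.def'.aestronglyMeasurable.indicator measurableSet_Iio
  · refine Eventually.of_forall fun s _ => LipschitzOnWith.of_dist_le_mul fun x _ y _ => ?_
    rw [Real.dist_eq, Real.dist_eq, ← sub_mul, abs_mul, mul_comm, Real.coe_nnabs]
    refine mul_le_mul_of_nonneg_left ?_ (abs_nonneg _)
    exact (abs_max_sub_max_le_abs (x - s) (y - s) 0).trans_eq (by rw [sub_sub_sub_cancel_right])
  · filter_upwards [compl_mem_ae_iff.2 (measure_singleton t)] with s hs _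
    rcases lt_or_gt_of_ne (show s ≠ t from hs) with h | h
    · rw [indicator_of_mem (mem_Iio.2 h)]
      have := (((hasDerivAt_id t).sub_const s).mul_const (g s))
      rw [one_mul] at this
      refine this.congr_of_eventuallyEq ?_
      filter_upwards [Ioi_mem_nhds h] with x hx
      rw [max_eq_left (by linarith [mem_Ioi.1 hx])]
      rfl
    · rw [indicator_of_notMem (by simpa using h.le)]
      refine (hasDerivAt_const t (0 : ℝ)).congr_of_eventuallyEq ?_
      filter_upwards [Iio_mem_nhds h] with x hx
      rw [max_eq_right (by linarith [mem_Iio.1 hx]), zero_mul]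

theorem kern_eq (t s : ℝ) :
    kern t s = (3 * t ^ 2 * s - t ^ 3) / 6 + max (t - s) 0 ^ 3 / 6 := by
  unfold kern
  split_ifs with h
  · rw [max_eq_right (by linarith)]
    ring
  · rw [max_eq_left (by linarith)]
    ring

theorem integral_kern_mul {g : ℝ → ℝ} (hg : IntervalIntegrable g volume 0 1) (t : ℝ) :
    ∫ s in (0:ℝ)..1, kern t s * g s =
      t ^ 2 / 2 * (∫ s in (0:ℝ)..1, s * g s) - t ^ 3 / 6 * (∫ s in (0:ℝ)..1, g s) +
        (∫ s in (0:ℝ)..1, max (t - s) 0 ^ 3 * g s) / 6 := by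
  have hsg : IntervalIntegrable (fun s => s * g s) volume 0 1 :=
    hg.continuousOn_mul continuousOn_id
  rw [← intervalIntegral.integral_const_mul, ← intervalIntegral.integral_const_mul,
    ← intervalIntegral.integral_div, ← intervalIntegral.integral_sub (hsg.const_mul _)
      (hg.const_mul _), ← intervalIntegral.integral_add ((hsg.const_mul _).sub (hg.const_mul _))
      ((intervalIntegrable_max_sub_zero_pow_mul hg 3 t).div_const _)]
  refine intervalIntegral.integral_congr fun s _ => ?_
  simp only [kern_eq]
  ring

/-- The third derivative of `t ↦ γ(t) c + ∫₀¹ k(t,s) g(s) ds`. -/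
theorem iterate_deriv_three_gam_add_integral_kern {g : ℝ → ℝ}
    (hg : IntervalIntegrable g volume 0 1) (c : ℝ) :
    deriv^[3] (fun t => gam t * c + ∫ s in (0:ℝ)..1, kern t s * g s) =
      fun t => -c - (∫ s in (0:ℝ)..1, g s) + ∫ s in (0:ℝ)..1, (Iio t).indicator g s := by
  simp only [integral_kern_mul hg, gam]
  set A := ∫ s in (0:ℝ)..1, s * g s
  set B := ∫ s in (0:ℝ)..1, g s
  have h1 : deriv (fun t : ℝ => (3 * t ^ 2 - t ^ 3) / 6 * c + (t ^ 2 / 2 * A - t ^ 3 / 6 * B +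
      (∫ s in (0:ℝ)..1, max (t - s) 0 ^ 3 * g s) / 6)) =
      fun t : ℝ => (t - t ^ 2 / 2) * c + (t * A - t ^ 2 / 2 * B +
        (∫ s in (0:ℝ)..1, max (t - s) 0 ^ 2 * g s) / 2) := by
    funext t
    have h2 := hasDerivAt_pow 2 t
    have h3 := hasDerivAt_pow 3 t
    refine HasDerivAt.deriv (((((h2.const_mul 3).sub h3).div_const 6).mul_const c |>.add
      ((((h2.div_const 2).mul_const A).sub ((h3.div_const 6).mul_const B)).add
        ((hasDerivAt_integral_max_sub_zero_pow hg 1 t).div_const 6))).congr_deriv ?_)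
    push_cast
    ring
  have h2 : deriv (fun t : ℝ => (t - t ^ 2 / 2) * c + (t * A - t ^ 2 / 2 * B +
        (∫ s in (0:ℝ)..1, max (t - s) 0 ^ 2 * g s) / 2)) =
      fun t : ℝ => (1 - t) * c + (A - t * B + ∫ s in (0:ℝ)..1, max (t - s) 0 * g s) := by
    funext t
    have h1 := hasDerivAt_id t
    have h2 := hasDerivAt_pow 2 t
    refine HasDerivAt.deriv (((h1.sub (h2.div_const 2)).mul_const c |>.add
      (((h1.mul_const A).sub ((h2.div_const 2).mul_const B)).add
        ((hasDerivAt_integral_max_sub_zero_pow hg 0 t).div_const 2))).congr_deriv ?_)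
    simp only [zero_add, pow_one]
    push_cast
    ring
  have h3 : deriv (fun t : ℝ => (1 - t) * c + (A - t * B +
        ∫ s in (0:ℝ)..1, max (t - s) 0 * g s)) =
      fun t => -c - B + ∫ s in (0:ℝ)..1, (Iio t).indicator g s := by
    funext t
    have h1 := hasDerivAt_id t
    refine HasDerivAt.deriv (((h1.const_sub 1).mul_const c |>.add
      (((h1.mul_const B).const_sub A).add
        (hasDerivAt_integral_max_sub_zero hg t))).congr_deriv ?_)
    ring
  simp only [Function.iterate_succ, Function.iterate_zero, Function.comp_apply, id_eq, h1, h2, h3]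

theorem abs_le_supN_of_bound {w : ℝ → ℝ} {M : ℝ} (hM : ∀ t ∈ Icc (0:ℝ) 1, |w t| ≤ M)
    {t : ℝ} (ht : t ∈ Icc (0:ℝ) 1) : |w t| ≤ supN w :=
  le_ciSup (f := fun t : Icc (0:ℝ) 1 => |w ↑t|)
    ⟨M, by rintro _ ⟨x, rfl⟩; exact hM x x.2⟩ ⟨t, ht⟩

theorem abs_le_supN {w : ℝ → ℝ} (hw : Continuous w) {t : ℝ} (ht : t ∈ Icc (0:ℝ) 1) :
    |w t| ≤ supN w := by
  obtain ⟨M, hM⟩ := isCompact_Icc.exists_bound_of_continuousOn (hw.continuousOn (s := Icc 0 1))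
  exact abs_le_supN_of_bound hM ht

theorem supN_const (c : ℝ) : supN (fun _ => c) = |c| := ciSup_const

/-- A lower bound for the norm given by the third derivative at `0`. -/
theorem le_norm3_gam_add_integral_kern {g : ℝ → ℝ}
    (hg : IntervalIntegrable g volume 0 1) (c : ℝ) :
    c + (∫ s in (0:ℝ)..1, g s) ≤
      norm3 (fun t => gam t * c + ∫ s in (0:ℝ)..1, kern t s * g s) := by
  refine le_trans ?_ ((le_max_right _ _).trans (le_max_right _ _))
  rw [iterate_deriv_three_gam_add_integral_kern hg]
  have hbound : ∀ t ∈ Icc (0:ℝ) 1,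
      |-c - (∫ s in (0:ℝ)..1, g s) + ∫ s in (0:ℝ)..1, (Iio t).indicator g s| ≤
        |-c - (∫ s in (0:ℝ)..1, g s)| + ∫ s in (0:ℝ)..1, |g s| := by
    refine fun t _ => (abs_add_le _ _).trans ?_
    gcongr
    rw [← Real.norm_eq_abs]
    exact intervalIntegral.norm_integral_le_of_norm_le zero_le_one
      (Eventually.of_forall fun s _ => norm_indicator_le_norm_self g s) hg.abs
  have hzero : ∫ s in (0:ℝ)..1, (Iio 0).indicator g s = 0 := by
    refine intervalIntegral.integral_zero_ae (Eventually.of_forall fun s hs => ?_)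
    rw [uIoc_of_le zero_le_one] at hs
    exact indicator_of_notMem (by simpa using hs.1.le) g
  have h0 := abs_le_supN_of_bound hbound (t := 0) (by simp)
  rw [hzero] at h0
  refine le_trans ?_ h0
  rw [add_zero, ← neg_add', abs_neg]
  exact le_abs_self _

theorem continuous_iterate_deriv {u : ℝ → ℝ} (hu : ContDiff ℝ 3 u) {n : ℕ} (hn : n ≤ 3) :
    Continuous (deriv^[n] u) := by
  rw [← iteratedDeriv_eq_iterate]
  exact hu.continuous_iteratedDeriv n (by exact_mod_cast hn)

theorem mem_PiSet_of_mem_Kbdry {ρ : ℝ} {u : ℝ → ℝ} (hu : u ∈ Kbdry ρ) {s : ℝ}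
    (hs : s ∈ Icc (0:ℝ) 1) :
    (s, u s, deriv u s, deriv^[2] u s, deriv^[3] u s) ∈ PiSet ρ := by
  obtain ⟨⟨hc, hpos⟩, hn⟩ := hu
  obtain ⟨p0, p1, p2, p3⟩ := hpos s hs
  have hn' := hn.le
  simp only [norm3, max_le_iff] at hn'
  obtain ⟨⟨n0, n1⟩, n2, n3⟩ := hn'
  have b0 := (abs_le_supN (continuous_iterate_deriv hc (n := 0) (by norm_num)) hs).trans n0
  have b1 := (abs_le_supN (continuous_iterate_deriv hc (n := 1) (by norm_num)) hs).trans n1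
  have b2 := (abs_le_supN (continuous_iterate_deriv hc (n := 2) (by norm_num)) hs).trans n2
  have b3 := (abs_le_supN (continuous_iterate_deriv hc (n := 3) le_rfl) hs).trans n3
  exact ⟨hs, ⟨p0, (abs_le.1 b0).2⟩, ⟨p1, (abs_le.1 b1).2⟩, ⟨p2, (abs_le.1 b2).2⟩,
    (abs_le.1 b3).1, by linarith⟩

theorem const_mem_Kbdry {ρ : ℝ} (hρ : 0 ≤ ρ) : (fun _ => ρ) ∈ Kbdry ρ := by
  have hd : deriv (fun _ : ℝ => ρ) = fun _ => 0 := by simp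
  have hd0 : deriv (fun _ : ℝ => (0:ℝ)) = fun _ => 0 := by simp
  refine ⟨⟨contDiff_const, fun t _ => ?_⟩, ?_⟩
  · simp [hd, hρ]
  · simp only [norm3, Function.iterate_succ, Function.iterate_zero, Function.comp_apply, id_eq,
      hd, hd0, supN_const]
    simp [abs_of_nonneg hρ, hρ]

/-- Under hypotheses (a) and (b) of Theorem 2.2, for every `u ∈ ∂K_ρ` one has
`‖Tu‖₃ ≥ η̲_ρ + ∫₀¹ δ̲_ρ(s) ds`, and hence
`inf_{u ∈ ∂K_ρ} ‖Tu‖₃ ≥ η̲_ρ + ∫₀¹ δ̲_ρ(s) ds`. -/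
theorem Toper_norm_lower_bound
    (ρ : ℝ) (hρ : 0 < ρ)
    (f : ℝ × ℝ × ℝ × ℝ × ℝ → ℝ) (hfc : ContinuousOn f (PiSet ρ))
    (δlo : ℝ → ℝ) (hδc : ContinuousOn δlo (Icc 0 1))
    (hδ0 : ∀ t ∈ Icc (0:ℝ) 1, 0 ≤ δlo t)
    (hfδ : ∀ p ∈ PiSet ρ, δlo p.1 ≤ f p)
    (H : (ℝ → ℝ) → ℝ) (hHc : ContOn3 H (Kbar ρ)) (hHb : BddOn3 H (Kbar ρ))
    (η : ℝ) (hη0 : 0 ≤ η) (hHη : ∀ u ∈ Kbdry ρ, η ≤ H u) :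
    (∀ u ∈ Kbdry ρ, η + (∫ s in (0:ℝ)..1, δlo s) ≤ norm3 (Toper f H u)) ∧
    η + (∫ s in (0:ℝ)..1, δlo s) ≤ sInf ((fun u => norm3 (Toper f H u)) '' Kbdry ρ) := by
  have hbound : ∀ u ∈ Kbdry ρ, η + (∫ s in (0:ℝ)..1, δlo s) ≤ norm3 (Toper f H u) := by
    intro u hu
    have hc (n : ℕ) (hn : n ≤ 3) : Continuous (deriv^[n] u) := continuous_iterate_deriv hu.1.1 hn
    have hmaps : MapsTo (fun s => (s, u s, deriv u s, deriv^[2] u s, deriv^[3] u s))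
        (Icc 0 1) (PiSet ρ) := fun s hs => mem_PiSet_of_mem_Kbdry hu hs
    have hg : IntervalIntegrable
        (fun s => f (s, u s, deriv u s, deriv^[2] u s, deriv^[3] u s)) volume 0 1 := by
      refine ContinuousOn.intervalIntegrable_of_Icc zero_le_one (hfc.comp ?_ hmaps)
      exact (continuous_id.prodMk ((hc 0 (by norm_num)).prodMk ((hc 1 (by norm_num)).prodMk
        ((hc 2 (by norm_num)).prodMk (hc 3 le_rfl))))).continuousOn
    refine le_trans (add_le_add (hHη u hu) ?_) (le_norm3_gam_add_integral_kern hg (H u))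
    exact intervalIntegral.integral_mono_on zero_le_one
      (hδc.intervalIntegrable_of_Icc zero_le_one) hg fun s hs => hfδ _ (hmaps hs)
  refine ⟨hbound, le_csInf ⟨_, mem_image_of_mem _ (const_mem_Kbdry hρ.le)⟩ ?_⟩
  rintro _ ⟨u, hu, rfl⟩
  exact hbound u hu
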